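/- Let X be a variable and e1, e2, e3 expressions, and let g2, g3 be expressions with X ∉ occ(g2) and X ∉ occ(g3) such that ν X = e2 ≡ ν X = g2 and ν X = e3 ≡ ν X = g3. Then ν X = (e1 → e2 ◇ e3) ≡ ν X = (e1[X := g2 ∨ g3] → g2 ◇ g3). -/

import Mathlib

namespace RESpaper

noncomputable section

/-- Addition on the extended reals in which `⊤` (i.e. `∞`) dominates. -/
def eadd (x y : EReal) : EReal := if x = ⊤ ∨ y = ⊤ then ⊤ else x + y

/-- The operator `eq-∞`. -/
def eqNegInfVal (x : EReal) : EReal := if x = ⊥ then ⊥ else ⊤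

/-- The operator `eq∞`. -/
def eqInfVal (x : EReal) : EReal := if x = ⊤ then ⊤ else ⊥

open Classical in
/-- The sum, with respect to `eadd`, of a finite family of extended reals. -/
def eSum {ι : Type*} (s : Finset ι) (e : ι → EReal) : EReal :=
  if ∃ i ∈ s, e i = ⊤ then ⊤ else ∑ i ∈ s, e i

/-- Syntax of expressions over a set `V` of variables. -/
inductive Expr (V : Type*) where
  | var : V → Expr V
  | const : EReal → Expr V
  | scale : {c : ℝ // 0 < c} → Expr V → Expr V
  | add : Expr V → Expr V → Expr V
  | emin : Expr V → Expr V → Expr V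
  | emax : Expr V → Expr V → Expr V
  | condL : Expr V → Expr V → Expr V → Expr V   -- (e₁ ⇒ e₂ ◇ e₃)
  | condR : Expr V → Expr V → Expr V → Expr V   -- (e₁ → e₂ ◇ e₃)
  | eqm : Expr V → Expr V                       -- eq-∞(e)

variable {V : Type*}

/-- Evaluation of an expression under a valuation `η`. -/
def Expr.eval (η : V → EReal) : Expr V → EReal
  | var X => η X
  | const d => d
  | scale c e => (c.1 : EReal) * Expr.eval η e
  | add e₁ e₂ => eadd (Expr.eval η e₁) (Expr.eval η e₂)
  | emin e₁ e₂ => Expr.eval η e₁ ⊓ Expr.eval η e₂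
  | emax e₁ e₂ => Expr.eval η e₁ ⊔ Expr.eval η e₂
  | condL e₁ e₂ e₃ =>
      if Expr.eval η e₁ ≤ 0 then Expr.eval η e₂ ⊓ Expr.eval η e₃ else Expr.eval η e₃
  | condR e₁ e₂ e₃ =>
      if Expr.eval η e₁ < 0 then Expr.eval η e₂ else Expr.eval η e₂ ⊔ Expr.eval η e₃
  | eqm e => eqNegInfVal (Expr.eval η e)

/-- The set of variables occurring in an expression. -/
def Expr.occ : Expr V → Set V
  | var X => {X}
  | const _ => ∅
  | scale _ e => Expr.occ e
  | add e₁ e₂ => Expr.occ e₁ ∪ Expr.occ e₂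
  | emin e₁ e₂ => Expr.occ e₁ ∪ Expr.occ e₂
  | emax e₁ e₂ => Expr.occ e₁ ∪ Expr.occ e₂
  | condL e₁ e₂ e₃ => Expr.occ e₁ ∪ Expr.occ e₂ ∪ Expr.occ e₃
  | condR e₁ e₂ e₃ => Expr.occ e₁ ∪ Expr.occ e₂ ∪ Expr.occ e₃
  | eqm e => Expr.occ e

/-- `e` contains no occurrence of the conditional operators. -/
def Expr.noCond : Expr V → Prop
  | var _ => True
  | const _ => True
  | scale _ e => Expr.noCond e
  | add e₁ e₂ => Expr.noCond e₁ ∧ Expr.noCond e₂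
  | emin e₁ e₂ => Expr.noCond e₁ ∧ Expr.noCond e₂
  | emax e₁ e₂ => Expr.noCond e₁ ∧ Expr.noCond e₂
  | condL _ _ _ => False
  | condR _ _ _ => False
  | eqm e => Expr.noCond e

/-- Syntactic substitution `e[X := g]`. -/
def Expr.subst [DecidableEq V] (X : V) (g : Expr V) : Expr V → Expr V
  | var Y => if Y = X then g else var Y
  | const d => const d
  | scale c e => scale c (Expr.subst X g e)
  | add e₁ e₂ => add (Expr.subst X g e₁) (Expr.subst X g e₂)
  | emin e₁ e₂ => emin (Expr.subst X g e₁) (Expr.subst X g e₂)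
  | emax e₁ e₂ => emax (Expr.subst X g e₁) (Expr.subst X g e₂)
  | condL e₁ e₂ e₃ => condL (Expr.subst X g e₁) (Expr.subst X g e₂) (Expr.subst X g e₃)
  | condR e₁ e₂ e₃ => condR (Expr.subst X g e₁) (Expr.subst X g e₂) (Expr.subst X g e₃)
  | eqm e => eqm (Expr.subst X g e)

/-- `(Σ_{(c,X) ∈ cs} c·X) + rest`. -/
def scaledSum (cs : List ({c : ℝ // 0 < c} × V)) (rest : Expr V) : Expr V :=
  cs.foldr (fun p acc => Expr.add (Expr.scale p.1 (Expr.var p.2)) acc) rest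

/-- `(Σ_{X ∈ ms} eq-∞(X)) + rest`. -/
def eqmSum (ms : List V) (rest : Expr V) : Expr V :=
  ms.foldr (fun X acc => Expr.add (Expr.eqm (Expr.var X)) acc) rest

/-- A term of the shape `(Σ_{X∈𝒳'} c^X·X) + (Σ_{X∈𝒳''} eq-∞(X)) + d`
with the variables in each of the two sums pairwise distinct. -/
def IsSimpleTerm (e : Expr V) : Prop :=
  ∃ (cs : List ({c : ℝ // 0 < c} × V)) (ms : List V) (d : EReal),
    (cs.map Prod.snd).Nodup ∧ ms.Nodup ∧ e = scaledSum cs (eqmSum ms (Expr.const d))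

/-- Finite disjunction; the empty disjunction is `−∞`. -/
def disjList : List (Expr V) → Expr V
  | [] => Expr.const ⊥
  | [e] => e
  | e :: es => Expr.emax e (disjList es)

/-- Finite conjunction; the empty conjunction is `∞`. -/
def conjList : List (Expr V) → Expr V
  | [] => Expr.const ⊤
  | [e] => e
  | e :: es => Expr.emin e (conjList es)

/-- Simple conjunctive normal form. -/
def IsSimpleCNF (e : Expr V) : Prop :=
  ∃ ls : List (List (Expr V)),
    (∀ l ∈ ls, ∀ t ∈ l, IsSimpleTerm t) ∧ e = conjList (ls.map disjList)

/-- Simple disjunctive normal form. -/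
def IsSimpleDNF (e : Expr V) : Prop :=
  ∃ ls : List (List (Expr V)),
    (∀ l ∈ ls, ∀ t ∈ l, IsSimpleTerm t) ∧ e = disjList (ls.map conjList)

/-- Conjunctive normal form. -/
inductive IsCNF : Expr V → Prop where
  | simple {e : Expr V} : IsSimpleCNF e → IsCNF e
  | condL {e₁ e₂ e₃ : Expr V} :
      IsSimpleCNF e₁ → IsCNF e₂ → IsCNF e₃ → IsCNF (Expr.condL e₁ e₂ e₃)
  | condR {e₁ e₂ e₃ : Expr V} :
      IsSimpleCNF e₁ → IsCNF e₂ → IsCNF e₃ → IsCNF (Expr.condR e₁ e₂ e₃)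

/-- Disjunctive normal form. -/
inductive IsDNF : Expr V → Prop where
  | simple {e : Expr V} : IsSimpleDNF e → IsDNF e
  | condL {e₁ e₂ e₃ : Expr V} :
      IsSimpleDNF e₁ → IsDNF e₂ → IsDNF e₃ → IsDNF (Expr.condL e₁ e₂ e₃)
  | condR {e₁ e₂ e₃ : Expr V} :
      IsSimpleDNF e₁ → IsDNF e₂ → IsDNF e₃ → IsDNF (Expr.condR e₁ e₂ e₃)

/-- Fixed-point symbols. -/
inductive FP where
  | mu : FP
  | nu : FP

/-- A real equation system: a finite sequence of fixed-point equations `σ X = e`. -/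
abbrev RES (V : Type*) := List (FP × V × Expr V)

/-- The bound variables of a RES. -/
def bnd (E : RES V) : List V := E.map (fun p => p.2.1)

variable [DecidableEq V]

/-- The solution `[[ℰ]]η` of a real equation system. -/
def sol : RES V → (V → EReal) → V → EReal
  | [], η => η
  | (FP.mu, X, e) :: E, η =>
      sol E (Function.update η X
        (sInf {r : EReal | Expr.eval (sol E (Function.update η X r)) e ≤ r}))
  | (FP.nu, X, e) :: E, η =>
      sol E (Function.update η X
        (sSup {r : EReal | r ≤ Expr.eval (sol E (Function.update η X r)) e}))

/-- Equivalence of real equation systems. -/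
def REquiv (E E' : RES V) : Prop :=
  ∀ F : RES V, (∀ Y ∈ bnd F, Y ∉ bnd E ∧ Y ∉ bnd E') →
    ∀ η : V → EReal, sol (E ++ F) η = sol (E' ++ F) η


theorem eadd_mono {a b c d : EReal} (hab : a ≤ b) (hcd : c ≤ d) : eadd a c ≤ eadd b d := by
  unfold eadd
  split_ifs with h₁ h₂ h₂
  · exact le_rfl
  · rcases h₁ with rfl | rfl
    · exact absurd (Or.inl (top_le_iff.mp hab)) h₂
    · exact absurd (Or.inr (top_le_iff.mp hcd)) h₂
  · exact le_top
  · exact add_le_add hab hcd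

theorem eqNegInfVal_mono {a b : EReal} (hab : a ≤ b) : eqNegInfVal a ≤ eqNegInfVal b := by
  unfold eqNegInfVal
  split_ifs with h₁ h₂ h₂
  · exact le_rfl
  · exact bot_le
  · exact absurd (le_bot_iff.mp (h₂ ▸ hab)) h₁
  · exact le_rfl

theorem Expr.eval_mono {W : Type*} (e : Expr W) : Monotone fun η : W → EReal => e.eval η := by
  intro η ζ h
  induction e with
  | var Y => exact h Y
  | const d => exact le_rfl
  | scale c e ih =>
    exact mul_le_mul_of_nonneg_left ih (EReal.coe_nonneg.mpr c.2.le)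
  | add e₁ e₂ ih₁ ih₂ => exact eadd_mono ih₁ ih₂
  | emin e₁ e₂ ih₁ ih₂ => exact inf_le_inf ih₁ ih₂
  | emax e₁ e₂ ih₁ ih₂ => exact sup_le_sup ih₁ ih₂
  | condL e₁ e₂ e₃ ih₁ ih₂ ih₃ =>
    simp only [Expr.eval] at ih₁ ih₂ ih₃ ⊢
    split_ifs with h₁ h₂ h₂
    · exact inf_le_inf ih₂ ih₃
    · exact inf_le_right.trans ih₃
    · exact absurd (ih₁.trans h₂) h₁
    · exact ih₃
  | condR e₁ e₂ e₃ ih₁ ih₂ ih₃ =>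
    simp only [Expr.eval] at ih₁ ih₂ ih₃ ⊢
    split_ifs with h₁ h₂ h₂
    · exact ih₂
    · exact ih₂.trans le_sup_left
    · exact absurd (ih₁.trans_lt h₂) h₁
    · exact sup_le_sup ih₂ ih₃
  | eqm e ih => exact eqNegInfVal_mono ih

theorem Expr.eval_update_of_notMem_occ {W : Type*} [DecidableEq W] {X : W} {e : Expr W}
    (hX : X ∉ e.occ) (η : W → EReal) (r : EReal) :
    e.eval (Function.update η X r) = e.eval η := by
  induction e with
  | var Y => exact Function.update_of_ne (fun h => hX h.symm) r η
  | _ => simp_all [Expr.eval, Expr.occ]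

theorem Expr.eval_subst {W : Type*} [DecidableEq W] (X : W) (g e : Expr W) (η : W → EReal) :
    (Expr.subst X g e).eval η = e.eval (Function.update η X (g.eval η)) := by
  induction e with
  | var Y =>
    by_cases h : Y = X
    · subst h; simp [Expr.subst, Expr.eval]
    · simp [Expr.subst, Expr.eval, h]
  | _ => simp_all [Expr.eval, Expr.subst]

theorem sol_mono (F : RES V) : Monotone (sol F) := by
  induction F with
  | nil => exact monotone_id
  | cons p F ih =>
    obtain ⟨σ, X, e⟩ := p
    intro η ζ h
    have hstep (r : EReal) : e.eval (sol F (Function.update η X r)) ≤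
        e.eval (sol F (Function.update ζ X r)) :=
      e.eval_mono (ih (update_le_update_iff.mpr ⟨le_rfl, fun Y _ => h Y⟩))
    cases σ with
    | mu =>
      exact ih (update_le_update_iff.mpr
        ⟨sInf_le_sInf fun r hr => (hstep r).trans hr, fun Y _ => h Y⟩)
    | nu =>
      exact ih (update_le_update_iff.mpr
        ⟨sSup_le_sSup fun r hr => le_trans hr (hstep r), fun Y _ => h Y⟩)

theorem sol_apply_of_notMem_bnd {X : V} {F : RES V} (hX : X ∉ bnd F) (η : V → EReal) :
    sol F η X = η X := by
  induction F generalizing η with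
  | nil => rfl
  | cons p F ih =>
    obtain ⟨σ, Y, e⟩ := p
    simp only [bnd, List.map_cons, List.mem_cons, not_or] at hX
    cases σ <;> exact (ih hX.2 _).trans (Function.update_of_ne hX.1 _ _)

/-- A monotone map takes the supremum of its post-fixed points to itself. -/
theorem map_sSup_postfixed {α : Type*} [CompleteLattice α] {f : α → α} (hf : Monotone f) :
    f (sSup {r | r ≤ f r}) = sSup {r | r ≤ f r} :=
  OrderHom.map_gfp ⟨f, hf⟩

theorem monotone_eval_update {W : Type*} [DecidableEq W] (X : W) (e : Expr W) (η : W → EReal) :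
    Monotone fun r => e.eval (Function.update η X r) :=
  fun _ _ h => e.eval_mono (update_le_update_iff.mpr ⟨h, fun _ _ => le_rfl⟩)

/-- If `g` pointwise computes the greatest fixed point of `e` in `X`, then `ν X = e` and `ν X = g`
are equivalent. -/
theorem REquiv.nu_of_sSup_eq {X : V} {e g : Expr V}
    (h : ∀ η : V → EReal, sSup {r | r ≤ e.eval (Function.update η X r)} = g.eval η) :
    REquiv [(FP.nu, X, e)] [(FP.nu, X, g)] := by
  intro F hF η
  have hX : X ∉ bnd F := fun hm => (hF X hm).1 (by simp [bnd])
  have hself (r : EReal) : Function.update (sol F (Function.update η X r)) X r =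
      sol F (Function.update η X r) :=
    Function.update_eq_self_iff.mpr (by simp [sol_apply_of_notMem_bnd hX])
  have hmono : Monotone fun r => g.eval (sol F (Function.update η X r)) := fun _ _ hr =>
    g.eval_mono (sol_mono F (update_le_update_iff.mpr ⟨hr, fun _ _ => le_rfl⟩))
  have key : sSup {r | r ≤ e.eval (sol F (Function.update η X r))} =
      sSup {r | r ≤ g.eval (sol F (Function.update η X r))} := by
    apply le_antisymm
    · refine sSup_le_sSup fun r hr => ?_
      rw [Set.mem_ofPred_eq, ← h]
      refine le_sSup ?_
      rw [Set.mem_ofPred_eq, hself]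
      exact hr
    · refine le_sSup ?_
      have hfix := map_sSup_postfixed hmono
      set s := sSup {r | r ≤ g.eval (sol F (Function.update η X r))}
      have he := map_sSup_postfixed (monotone_eval_update X e (sol F (Function.update η X s)))
      rw [h, hfix, hself] at he
      exact he.ge
  simp only [List.cons_append, List.nil_append, sol, key]

theorem REquiv.sSup_eq_of_nu {X : V} {e g : Expr V} (hg : X ∉ g.occ)
    (h : REquiv [(FP.nu, X, e)] [(FP.nu, X, g)]) (η : V → EReal) :
    sSup {r | r ≤ e.eval (Function.update η X r)} = g.eval η := by
  have hX := congrFun (h [] (by simp [bnd]) η) X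
  simp only [List.append_nil, sol, Function.update_self,
    Expr.eval_update_of_notMem_occ hg] at hX
  exact hX.trans (isLUB_Iic (a := g.eval η)).sSup_eq

/-- The greatest fixed point of a conditional `r ↦ (f₁ r → f₂ r ◇ f₃ r)` of monotone maps on a
complete linear order. -/
theorem sSup_le_cond_eq {α : Type*} [CompleteLinearOrder α] {f₁ f₂ f₃ : α → α} (c : α)
    (hf₁ : Monotone f₁) (hf₂ : Monotone f₂) (hf₃ : Monotone f₃) {a b : α}
    (ha : sSup {r | r ≤ f₂ r} = a) (hb : sSup {r | r ≤ f₃ r} = b) :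
    sSup {r | r ≤ if f₁ r < c then f₂ r else f₂ r ⊔ f₃ r} =
      if f₁ (a ⊔ b) < c then a else a ⊔ b := by
  have hfa : f₂ a = a := ha ▸ map_sSup_postfixed hf₂
  have hfb : f₃ b = b := hb ▸ map_sSup_postfixed hf₃
  have hle₂ {r : α} (hr : r ≤ f₂ r) : r ≤ a := ha ▸ le_sSup hr
  have hle₃ {r : α} (hr : r ≤ f₃ r) : r ≤ b := hb ▸ le_sSup hr
  have hbound {r : α} (hr : r ≤ if f₁ r < c then f₂ r else f₂ r ⊔ f₃ r) : r ≤ a ⊔ b := by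
    split_ifs at hr
    · exact (hle₂ hr).trans le_sup_left
    · exact (le_sup_iff.mp hr).elim (fun h => (hle₂ h).trans le_sup_left)
        fun h => (hle₃ h).trans le_sup_right
  refine IsLUB.sSup_eq (IsGreatest.isLUB ⟨?_, fun r hr => ?_⟩)
  · split_ifs with h
    · rw [Set.mem_ofPred_eq, hfa]
      split_ifs
      · exact le_rfl
      · exact le_sup_left
    · rw [Set.mem_ofPred_eq, if_neg h]
      exact sup_le_sup (hfa.ge.trans (hf₂ le_sup_left)) (hfb.ge.trans (hf₃ le_sup_right))
  · split_ifs with h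
    · have hr' : r ≤ _ := hr
      rw [if_pos ((hf₁ (hbound hr)).trans_lt h)] at hr'
      exact hle₂ hr'
    · exact hbound hr

/-- solving `ν X = (e₁ → e₂ ◇ e₃)`. -/
theorem sol_condR_nu (X : V) (e₁ e₂ e₃ g₂ g₃ : Expr V)
    (hg₂ : X ∉ g₂.occ) (hg₃ : X ∉ g₃.occ)
    (h2 : REquiv [(FP.nu, X, e₂)] [(FP.nu, X, g₂)])
    (h3 : REquiv [(FP.nu, X, e₃)] [(FP.nu, X, g₃)]) :
    REquiv [(FP.nu, X, Expr.condR e₁ e₂ e₃)]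
      [(FP.nu, X, Expr.condR (Expr.subst X (Expr.emax g₂ g₃) e₁) g₂ g₃)] := by
  refine REquiv.nu_of_sSup_eq fun η => ?_
  simp only [Expr.eval, Expr.eval_subst]
  exact sSup_le_cond_eq 0 (monotone_eval_update X e₁ η) (monotone_eval_update X e₂ η)
    (monotone_eval_update X e₃ η) (h2.sSup_eq_of_nu hg₂ η) (h3.sSup_eq_of_nu hg₃ η)

end
end RESpaper
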